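/- Let A ∈ ℝ^{pn×pn} be a symmetric positive definite weakly admissible BLR² matrix with p blocks of size n, skeleton width r ≤ n, shared bases U_0,…,U_{p−1} and skeleton blocks S_{ij}, and let Â = (U^F)ᵀ A U^F with U^F = blockDiag(U_0,…,U_{p−1}). For each i write Â_{ii} in 2×2 block form with blocks Â_{ii}^{RR} ∈ ℝ^{(n−r)×(n−r)}, Â_{ii}^{RS}, Â_{ii}^{SR}, Â_{ii}^{SS}, suppose L_i is an invertible lower triangular matrix with L_i L_iᵀ = Â_{ii}^{RR}, and set L_i^{SR} = Â_{ii}^{SR} (L_iᵀ)⁻¹, Ã_i = Â_{ii}^{SS} − L_i^{SR} (L_i^{SR})ᵀ, and L̂ = blockDiag over i of (fromBlocks L_i 0 L_i^{SR} I_r). Then Â = L̂ · Â' · L̂ᵀ, where Â' is the symmetric matrix whose diagonal (i,i) block equals fromBlocks I 0 0 Ã_i and whose off-diagonal (i,j) block (i ≠ j) equals fromBlocks 0 0 0 S_{ij}. -/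

import Mathlib

open Matrix

/-- The skeleton part `U^S` of a basis matrix: the last `r` columns, when the columns are
indexed by `Fin q ⊕ Fin r` (`q = n - r` redundant columns followed by `r` skeleton columns). -/
def skelCols {α : Type*} {q r : ℕ} (U : Matrix α (Fin q ⊕ Fin r) ℝ) : Matrix α (Fin r) ℝ :=
  U.submatrix id Sum.inr

/-- The `(i, j)` block (of size `n × n`, `n = q + r`) of a `p × p` block matrix whose global
index type is `(Fin q ⊕ Fin r) × Fin p` (within-block index first, block index second,
matching `Matrix.blockDiagonal`). -/
def blk {q r p : ℕ}
    (A : Matrix ((Fin q ⊕ Fin r) × Fin p) ((Fin q ⊕ Fin r) × Fin p) ℝ) (i j : Fin p) :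
    Matrix (Fin q ⊕ Fin r) (Fin q ⊕ Fin r) ℝ :=
  Matrix.of fun a b => A (a, i) (b, j)

/-- Lower triangular predicate for a square matrix indexed by `Fin k`. -/
def IsLowerTri {k : ℕ} (L : Matrix (Fin k) (Fin k) ℝ) : Prop :=
  ∀ i j : Fin k, i < j → L i j = 0

theorem blk_injective {q r p : ℕ}
    {A B : Matrix ((Fin q ⊕ Fin r) × Fin p) ((Fin q ⊕ Fin r) × Fin p) ℝ}
    (h : ∀ i j, blk A i j = blk B i j) : A = B := by
  ext ⟨a, i⟩ ⟨b, j⟩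
  exact congrFun (congrFun (h i j) a) b

theorem blk_transpose {q r p : ℕ}
    (A : Matrix ((Fin q ⊕ Fin r) × Fin p) ((Fin q ⊕ Fin r) × Fin p) ℝ) (i j : Fin p) :
    blk Aᵀ i j = (blk A j i)ᵀ := rfl

theorem blk_mul_blockDiagonal {q r p : ℕ}
    (A : Matrix ((Fin q ⊕ Fin r) × Fin p) ((Fin q ⊕ Fin r) × Fin p) ℝ)
    (U : Fin p → Matrix (Fin q ⊕ Fin r) (Fin q ⊕ Fin r) ℝ) (i j : Fin p) :
    blk (A * blockDiagonal U) i j = blk A i j * U j := by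
  ext a b
  simp only [blk, of_apply, mul_apply, blockDiagonal_apply, Fintype.sum_prod_type]
  refine Finset.sum_congr rfl fun c _ => ?_
  simp

theorem blk_blockDiagonal_mul {q r p : ℕ}
    (U : Fin p → Matrix (Fin q ⊕ Fin r) (Fin q ⊕ Fin r) ℝ)
    (A : Matrix ((Fin q ⊕ Fin r) × Fin p) ((Fin q ⊕ Fin r) × Fin p) ℝ) (i j : Fin p) :
    blk (blockDiagonal U * A) i j = U i * blk A i j := by
  ext a b
  simp only [blk, of_apply, mul_apply, blockDiagonal_apply, Fintype.sum_prod_type]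
  refine Finset.sum_congr rfl fun c _ => ?_
  simp

theorem transpose_mul_skelCols {q r : ℕ} {U : Matrix (Fin q ⊕ Fin r) (Fin q ⊕ Fin r) ℝ}
    (hU : Uᵀ * U = 1) : Uᵀ * skelCols U = fromRows 0 1 := by
  ext a b
  have h := congrFun (congrFun hU a) (Sum.inr b)
  rw [mul_apply] at h
  rw [mul_apply]
  refine h.trans ?_
  rcases a with a | a <;> simp [one_apply]

/-- In orthogonal coordinates a low-rank block reduces to its skeleton coupling. -/
theorem transpose_mul_skelCols_mul {q r : ℕ}
    {U V : Matrix (Fin q ⊕ Fin r) (Fin q ⊕ Fin r) ℝ} (hU : Uᵀ * U = 1) (hV : Vᵀ * V = 1)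
    (S : Matrix (Fin r) (Fin r) ℝ) :
    Uᵀ * (skelCols U * S * (skelCols V)ᵀ) * V = fromBlocks 0 0 0 S := by
  have hV' : (skelCols V)ᵀ * V = fromCols 0 1 := by
    have h := congrArg transpose (transpose_mul_skelCols hV)
    simpa [transpose_fromRows] using h
  calc Uᵀ * (skelCols U * S * (skelCols V)ᵀ) * V
      = (Uᵀ * skelCols U) * S * ((skelCols V)ᵀ * V) := by simp only [Matrix.mul_assoc]
    _ = fromBlocks 0 0 0 S := by
      rw [transpose_mul_skelCols hU, hV', fromRows_mul, fromRows_mul_fromCols]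
      simp

/-- Partial Cholesky factorization of a symmetric two-by-two block matrix. -/
theorem partial_cholesky {q r : ℕ} {M : Matrix (Fin q ⊕ Fin r) (Fin q ⊕ Fin r) ℝ}
    (hM : Mᵀ = M) {L : Matrix (Fin q) (Fin q) ℝ} (hL : IsUnit L.det)
    (hchol : L * Lᵀ = M.toBlocks₁₁) {K : Matrix (Fin r) (Fin q) ℝ}
    (hK : K = M.toBlocks₂₁ * (Lᵀ)⁻¹) :
    fromBlocks L 0 K 1 * fromBlocks 1 0 0 (M.toBlocks₂₂ - K * Kᵀ) * (fromBlocks L 0 K 1)ᵀ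
      = M := by
  have hKL : K * Lᵀ = M.toBlocks₂₁ := by
    rw [hK, nonsing_inv_mul_cancel_right _ _ (by rwa [det_transpose])]
  have hLK : L * Kᵀ = M.toBlocks₁₂ := by
    have h : (M.toBlocks₂₁)ᵀ = M.toBlocks₁₂ := congrArg toBlocks₁₂ hM
    rw [← h, ← hKL, transpose_mul, transpose_transpose]
  conv_rhs => rw [← fromBlocks_toBlocks M]
  simp [fromBlocks_transpose, fromBlocks_multiply, hchol, hKL, hLK]

/-- Diagonal product followed by partial factorization (lines 2–3 of
Algorithm 1).  Let `A` be a symmetric positive definite weakly admissible BLR² matrix with `p`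
blocks of size `n = q + r`, skeleton width `r`, shared orthogonal bases `U i` and skeleton
blocks `S i j`, and let `Â = (U^F)ᵀ A U^F` with `U^F = blockDiag (U_0, …, U_{p-1})`.  For each
`i`, let `L i` be an invertible lower triangular Cholesky factor of `Â_{ii}^{RR}`, let
`L_i^{SR} = Â_{ii}^{SR} (L iᵀ)⁻¹`, `Ã_i = Â_{ii}^{SS} - L_i^{SR} (L_i^{SR})ᵀ`, and let
`L̂ = blockDiag_i (fromBlocks (L i) 0 (L_i^{SR}) 1)`.  Then `Â = L̂ * Â' * L̂ᵀ`, where `Â'` is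
the matrix with diagonal blocks `fromBlocks 1 0 0 (Ã_i)` and off-diagonal blocks
`fromBlocks 0 0 0 (S i j)`. -/
theorem blr2_partial_factorization {q r p : ℕ}
    (U : Fin p → Matrix (Fin q ⊕ Fin r) (Fin q ⊕ Fin r) ℝ)
    (hU : ∀ i, (U i)ᵀ * U i = 1)
    (S : Fin p → Fin p → Matrix (Fin r) (Fin r) ℝ)
    (A : Matrix ((Fin q ⊕ Fin r) × Fin p) ((Fin q ⊕ Fin r) × Fin p) ℝ)
    (hsym : Aᵀ = A) (hpd : A.PosDef)
    (hblr : ∀ i j, i ≠ j → blk A i j = skelCols (U i) * S i j * (skelCols (U j))ᵀ)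
    (Ahat : Matrix ((Fin q ⊕ Fin r) × Fin p) ((Fin q ⊕ Fin r) × Fin p) ℝ)
    (hAhat : Ahat = (Matrix.blockDiagonal U)ᵀ * A * Matrix.blockDiagonal U)
    (L : Fin p → Matrix (Fin q) (Fin q) ℝ)
    (hLtri : ∀ i, IsLowerTri (L i)) (hLinv : ∀ i, IsUnit (L i).det)
    (hchol : ∀ i, L i * (L i)ᵀ = (blk Ahat i i).toBlocks₁₁)
    (LSR : Fin p → Matrix (Fin r) (Fin q) ℝ)
    (hLSR : ∀ i, LSR i = (blk Ahat i i).toBlocks₂₁ * ((L i)ᵀ)⁻¹)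
    (Atil : Fin p → Matrix (Fin r) (Fin r) ℝ)
    (hAtil : ∀ i, Atil i = (blk Ahat i i).toBlocks₂₂ - LSR i * (LSR i)ᵀ)
    (Lhat : Matrix ((Fin q ⊕ Fin r) × Fin p) ((Fin q ⊕ Fin r) × Fin p) ℝ)
    (hLhat : Lhat = Matrix.blockDiagonal fun i => Matrix.fromBlocks (L i) 0 (LSR i) 1)
    (A' : Matrix ((Fin q ⊕ Fin r) × Fin p) ((Fin q ⊕ Fin r) × Fin p) ℝ)
    (hA'sym : A'ᵀ = A')
    (hA'diag : ∀ i, blk A' i i = Matrix.fromBlocks 1 0 0 (Atil i))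
    (hA'off : ∀ i j, i ≠ j → blk A' i j = Matrix.fromBlocks 0 0 0 (S i j)) :
    Ahat = Lhat * A' * Lhatᵀ := by
  have hsymhat : Ahatᵀ = Ahat := by
    rw [hAhat]
    simp only [transpose_mul, transpose_transpose, hsym, Matrix.mul_assoc]
  apply blk_injective
  intro i j
  rw [hLhat, blockDiagonal_transpose, blk_mul_blockDiagonal, blk_blockDiagonal_mul]
  by_cases hij : i = j
  · subst hij
    have hdiag : (blk Ahat i i)ᵀ = blk Ahat i i := by rw [← blk_transpose, hsymhat]
    rw [hA'diag, hAtil, partial_cholesky hdiag (hLinv i) (hchol i) (hLSR i)]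
  · rw [hA'off i j hij, hAhat, blockDiagonal_transpose, blk_mul_blockDiagonal,
      blk_blockDiagonal_mul, hblr i j hij, transpose_mul_skelCols_mul (hU i) (hU j)]
    simp [fromBlocks_transpose, fromBlocks_multiply]
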